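/- arXiv:2003.02397 — 3 statements merged into one kernel-verified Lean document; each statement's English description precedes it below -/
import Mathlib

section
/- Let H and Q be nonempty linear subspaces of P^n over an infinite field, with Q general of codimension 2. Then for every d ≥ 1, the dimension of [I(H) ∩ I(Q)^{d-1}]_d (degree-d forms vanishing on H and vanishing to order d-1 along Q) equals d·(codim H). In particular, if a finite set of points Z is contained in H, then dim [I(Z) ∩ I(Q)^{d-1}]_d ≥ d·(codim H). -/
open MvPolynomial Module

section MonomialCase

variable {K σ : Type*} [Field K]

lemma le_add_of_mem_span_pair_X_pow {p q : σ} {k : ℕ} {f : MvPolynomial σ K}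
    (hf : f ∈ Ideal.span {(X p : MvPolynomial σ K), X q} ^ k) {m : σ →₀ ℕ} (hm : m ∈ f.support) :
    k ≤ m p + m q := by
  classical
  have key : Ideal.span {(X p : MvPolynomial σ K), X q} ^ k ≤
      Ideal.span ((fun m : σ →₀ ℕ => monomial m (1 : K)) '' {m | k ≤ m p + m q}) := by
    clear hf
    induction k with
    | zero =>
      intro f _
      rw [mem_ideal_span_monomial_image]
      exact fun m _ => ⟨m, by simp, le_rfl⟩
    | succ k ih =>
      rw [pow_succ]
      refine (Ideal.mul_mono_left ih).trans ?_
      rw [Ideal.span_mul_span', Ideal.span_le]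
      rintro _ ⟨_, ⟨m, hm, rfl⟩, x, hx, rfl⟩
      simp only [Set.mem_ofPred_eq] at hm
      rcases hx with rfl | rfl
      · refine Ideal.subset_span ⟨m + Finsupp.single p 1, ?_, ?_⟩
        · simp
          omega
        · simp [X, monomial_mul]
      · refine Ideal.subset_span ⟨m + Finsupp.single q 1, ?_, ?_⟩
        · simp
          omega
        · simp [X, monomial_mul]
  obtain ⟨m', hm', hle⟩ := mem_ideal_span_monomial_image.1 (key hf) m hm
  exact le_trans hm' (add_le_add (hle p) (hle q))

lemma finrank_span_X_inf_span_pair_X_pow [Finite σ] {c d : ℕ} (hd : 1 ≤ d) {s : Fin c → σ}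
    (hs : Function.Injective s) {p q : σ} (hpq : p ≠ q) (hp : p ∉ Set.range s)
    (hq : q ∉ Set.range s ∨ ∀ j ≠ p, j ∈ Set.range s) :
    finrank K ↥(Submodule.restrictScalars K
      (Ideal.span (Set.range fun i => (X (s i) : MvPolynomial σ K)) ⊓
        Ideal.span {(X p : MvPolynomial σ K), X q} ^ (d - 1)) ⊓ homogeneousSubmodule σ K d) =
      d * c := by
  classical
  have := Fintype.ofFinite σ
  let E : Fin c × Fin d → (σ →₀ ℕ) := fun x =>
    Finsupp.single (s x.1) 1 + Finsupp.single p x.2.1 + Finsupp.single q (d - 1 - x.2.1)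
  have hsp : ∀ i, s i ≠ p := fun i h => hp ⟨i, h⟩
  have hEinj : Function.Injective E := by
    rintro ⟨i, a⟩ ⟨i', a'⟩ h
    have ha : a = a' := by
      have := DFunLike.congr_fun h p
      simp [E, hsp, hpq.symm] at this
      exact Fin.ext this
    subst ha
    simp only [E, add_left_inj] at h
    rw [Finsupp.single_left_inj one_ne_zero] at h
    rw [hs h]
  have hspan : Submodule.restrictScalars K
      (Ideal.span (Set.range fun i => (X (s i) : MvPolynomial σ K)) ⊓
        Ideal.span {(X p : MvPolynomial σ K), X q} ^ (d - 1)) ⊓ homogeneousSubmodule σ K d =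
      Submodule.span K (Set.range fun x => monomial (E x) (1 : K)) := by
    apply le_antisymm
    · rintro f ⟨⟨hI, hJ⟩, hH⟩
      rw [Set.range_comp' (fun m => monomial m (1 : K)) E, ← restrictSupport_eq_span,
        mem_restrictSupport_iff]
      intro m hm
      have h1 := le_add_of_mem_span_pair_X_pow hJ hm
      rw [SetLike.mem_coe, Set.range_comp' X s, mem_ideal_span_X_image] at hI
      obtain ⟨_, ⟨i, rfl⟩, hi⟩ := hI m hm
      have h2 : m.degree = d := by
        by_contra hne
        exact (mem_support_iff.1 hm) (hH.coeff_eq_zero hne)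
      have hlt : m p + m (s i) ≤ d := by
        have hle : Finsupp.single p (m p) + Finsupp.single (s i) (m (s i)) ≤ m := by
          intro j
          have := hsp i
          by_cases hjp : j = p <;> by_cases hji : j = s i <;> simp_all
        simpa [h2] using Finsupp.degree_mono hle
      have hle : Finsupp.single p (m p) + Finsupp.single q (d - 1 - m p) ≤ m := by
        intro j
        by_cases hjp : j = p <;> by_cases hjq : j = q <;> simp_all
        omega
      obtain ⟨t, ht⟩ := exists_add_of_le hle
      have htd : t.degree = 1 := by
        have := congrArg Finsupp.degree ht
        simp only [map_add, Finsupp.degree_single, h2] at this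
        omega
      obtain ⟨r, rfl⟩ : t ∈ Set.range fun r : σ => Finsupp.single r 1 := by
        rw [Finsupp.range_single_one]
        exact htd
      have hrp : r ≠ p := by
        rintro rfl
        have := DFunLike.congr_fun ht r
        simp [hpq.symm] at this
      have hr : r ∈ Set.range s := by
        by_cases hiq : s i = q
        · exact hq.resolve_left (fun h => h ⟨i, hiq⟩) r hrp
        · refine ⟨i, ?_⟩
          by_contra hne
          have := DFunLike.congr_fun ht (s i)
          simp [hsp, hiq, Ne.symm hne] at this
          exact hi this
      obtain ⟨i', rfl⟩ := hr
      have hmp : m p < d := by omega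
      refine ⟨⟨i', ⟨m p, hmp⟩⟩, ?_⟩
      conv_rhs => rw [ht]
      simp only [E]
      abel
    · rw [Submodule.span_le]
      rintro _ ⟨⟨i, a⟩, rfl⟩
      have hE : monomial (E (i, a)) (1 : K) = X (s i) * (X p ^ a.1 * X q ^ (d - 1 - a.1)) := by
        simp [E, X, monomial_pow, monomial_mul, add_assoc]
      have had : a.1 + (d - 1 - a.1) = d - 1 := by omega
      refine ⟨⟨?_, ?_⟩, ?_⟩
      · change monomial (E (i, a)) (1 : K) ∈ _
        rw [hE]
        exact Ideal.mul_mem_right _ _ (Ideal.subset_span ⟨i, rfl⟩)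
      · change monomial (E (i, a)) (1 : K) ∈ Ideal.span {(X p : MvPolynomial σ K), X q} ^ (d - 1)
        have hmul := Ideal.mul_mem_mul
          (Ideal.pow_mem_pow (Ideal.subset_span (Set.mem_insert (X p : MvPolynomial σ K) {X q})) a.1)
          (Ideal.pow_mem_pow (Ideal.subset_span
            (Set.mem_insert_of_mem (X p : MvPolynomial σ K) (Set.mem_singleton (X q))))
            (d - 1 - a.1))
        rw [← pow_add, had] at hmul
        rw [hE]
        exact Ideal.mul_mem_left _ _ hmul
      · have hdeg : (E (i, a)).degree = d := by
          simp only [E, map_add, Finsupp.degree_single]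
          omega
        exact isHomogeneous_monomial 1 hdeg
  rw [hspan, finrank_span_eq_card]
  · simp [mul_comm]
  · have := (basisMonomials σ K).linearIndependent.comp E hEinj
    simpa [Function.comp_def] using this

end MonomialCase

section LinearForms

variable {K σ : Type*} [Field K] [Fintype σ]

/-- The linear form with given coefficients. -/
noncomputable def linForm : (σ → K) →ₗ[K] MvPolynomial σ K :=
  Fintype.linearCombination K X

lemma linForm_apply (v : σ → K) : linForm v = ∑ j, C (v j) * X j := by
  simp [linForm, Fintype.linearCombination_apply, smul_eq_C_mul]

lemma range_linForm :
    LinearMap.range (linForm : (σ → K) →ₗ[K] MvPolynomial σ K) = homogeneousSubmodule σ K 1 := by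
  rw [linForm, Fintype.range_linearCombination, homogeneousSubmodule_one_eq_span_X]

lemma exists_algEquiv_X_eq_linForm {b : σ → σ → K} (hb : LinearIndependent K b) :
    ∃ e : MvPolynomial σ K ≃ₐ[K] MvPolynomial σ K, (∀ j, e (X j) = linForm (b j)) ∧
      ∀ (d : ℕ) (f : MvPolynomial σ K), (e f).IsHomogeneous d ↔ f.IsHomogeneous d := by
  classical
  let M : Matrix σ σ K := b
  have hM : IsUnit M.det := by
    rw [← Matrix.isUnit_iff_isUnit_det]
    exact Matrix.linearIndependent_rows_iff_isUnit.1 hb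
  have hcomp : ∀ M N : Matrix σ σ K, M * N = 1 →
      (bind₁ N.toMvPolynomial).comp (bind₁ M.toMvPolynomial) = AlgHom.id K _ := by
    intro M N h
    ext1 i
    simp [← Matrix.toMvPolynomial_mul, h]
  have hhom : ∀ (N : Matrix σ σ K) (d : ℕ) (f : MvPolynomial σ K), f.IsHomogeneous d →
      (bind₁ N.toMvPolynomial f).IsHomogeneous d := by
    intro N d f hf
    simpa using hf.aeval N.toMvPolynomial N.toMvPolynomial_isHomogeneous
  refine ⟨AlgEquiv.ofAlgHom (bind₁ M.toMvPolynomial) (bind₁ M⁻¹.toMvPolynomial)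
    (hcomp _ _ (Matrix.nonsing_inv_mul _ hM)) (hcomp _ _ (Matrix.mul_nonsing_inv _ hM)), ?_, ?_⟩
  · intro j
    simp [Matrix.toMvPolynomial, linForm_apply, C_mul_X_eq_monomial, M]
  · refine fun d f => ⟨fun h => ?_, hhom _ d f⟩
    have := hhom M⁻¹ d _ h
    have h2 := DFunLike.congr_fun (hcomp _ _ (Matrix.mul_nonsing_inv _ hM)) f
    simp only [AlgHom.comp_apply, AlgHom.id_apply] at h2
    simpa [h2] using this

lemma finrank_span_inf_span_pair_pow_of_adapted {c d : ℕ} (hd : 1 ≤ d) {s : Fin c → σ}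
    (hs : Function.Injective s) {p q : σ} (hpq : p ≠ q) (hp : p ∉ Set.range s)
    (hq : q ∉ Set.range s ∨ ∀ j ≠ p, j ∈ Set.range s) {b : σ → σ → K}
    (hb : LinearIndependent K b) {I J : Ideal (MvPolynomial σ K)}
    (hI : I = Ideal.span (Set.range fun i => linForm (b (s i))))
    (hJ : J = Ideal.span {linForm (b p), linForm (b q)}) :
    finrank K ↥(Submodule.restrictScalars K (I ⊓ J ^ (d - 1)) ⊓ homogeneousSubmodule σ K d) =
      d * c := by
  obtain ⟨e, he, hhom⟩ := exists_algEquiv_X_eq_linForm hb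
  rw [← finrank_span_X_inf_span_pair_X_pow (K := K) hd hs hpq hp hq]
  have hI' : I = Ideal.map e (Ideal.span (Set.range fun i => (X (s i) : MvPolynomial σ K))) := by
    rw [hI, Ideal.map_span, ← Set.range_comp]
    simp [Function.comp_def, he]
  have hJ' : J = Ideal.map e (Ideal.span {(X p : MvPolynomial σ K), X q}) := by
    rw [hJ, Ideal.map_span]
    simp [Set.image_pair, he]
  have hmem : ∀ (L : Ideal (MvPolynomial σ K)) (f : MvPolynomial σ K),
      e f ∈ Ideal.map e L ↔ f ∈ L := by
    intro L f
    refine ⟨fun h => ?_, Ideal.mem_map_of_mem e⟩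
    obtain ⟨g, hg, hgf⟩ := (Ideal.mem_map_iff_of_surjective e e.surjective).1 h
    rwa [← e.injective hgf]
  have hmap : Submodule.restrictScalars K (I ⊓ J ^ (d - 1)) ⊓ homogeneousSubmodule σ K d =
      Submodule.map (e.toLinearEquiv : MvPolynomial σ K →ₗ[K] MvPolynomial σ K)
        (Submodule.restrictScalars K
          (Ideal.span (Set.range fun i => (X (s i) : MvPolynomial σ K)) ⊓
            Ideal.span {(X p : MvPolynomial σ K), X q} ^ (d - 1)) ⊓ homogeneousSubmodule σ K d) := by
    ext f
    obtain ⟨f, rfl⟩ := e.surjective f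
    rw [hI', hJ', ← Ideal.map_pow]
    simp only [Submodule.mem_inf, Submodule.restrictScalars_mem, hmem, mem_homogeneousSubmodule,
      hhom, Submodule.mem_map]
    constructor
    · exact fun h => ⟨f, h, rfl⟩
    · rintro ⟨g, hg, hgf⟩
      rwa [← e.injective hgf]
  rw [hmap, LinearEquiv.finrank_map_eq e.toLinearEquiv]

lemma exists_linearIndependent_extension {c : ℕ} (hc : 1 ≤ c) (hcn : c < Fintype.card σ)
    {v : Fin c → σ → K} (hv : LinearIndependent K v) :
    ∃ (b : σ → σ → K) (s : Fin c → σ) (p q : σ), LinearIndependent K b ∧ Function.Injective s ∧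
      (∀ i, b (s i) = v i) ∧ p ≠ q ∧ p ∉ Set.range s ∧
      (q ∉ Set.range s ∨ ∀ j ≠ p, j ∈ Set.range s) := by
  classical
  let B := Basis.sumExtend hv
  let ε := B.indexEquiv (Pi.basisFun K σ)
  let s : Fin c → σ := fun i => ε (Sum.inl i)
  have hs : Function.Injective s := ε.injective.comp Sum.inl_injective
  obtain ⟨p, hp⟩ : ∃ p, p ∉ Set.range s := by
    by_contra! h
    have := Fintype.card_le_of_surjective s h
    simp at this
    omega
  have hB : ∀ i, B (Sum.inl i) = v i := by
    intro i
    simp [B, Basis.sumExtend]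
    rfl
  refine ⟨B ∘ ε.symm, s, p, ?_⟩
  by_cases h : ∃ q, q ≠ p ∧ q ∉ Set.range s
  · obtain ⟨q, hqp, hq⟩ := h
    exact ⟨q, B.linearIndependent.comp _ ε.symm.injective, hs, by simp [s, hB], hqp.symm, hp,
      .inl hq⟩
  · refine ⟨s ⟨0, hc⟩, B.linearIndependent.comp _ ε.symm.injective, hs, by simp [s, hB],
      fun h => hp ⟨_, h.symm⟩, hp, .inr fun j hj => ?_⟩
    by_contra hjs
    exact h ⟨j, hj, hjs⟩

lemma linearIndependent_iff_det_of_ne_zero [DecidableEq σ] {b : σ → σ → K} :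
    LinearIndependent K b ↔ (Matrix.of b).det ≠ 0 := by
  rw [← isUnit_iff_ne_zero, ← Matrix.isUnit_iff_isUnit_det]
  exact Matrix.linearIndependent_rows_iff_isUnit (A := Matrix.of b)

lemma exists_ne_zero_linearIndependent_update [DecidableEq σ] {b : σ → σ → K}
    (hb : LinearIndependent K b) (p q : σ) :
    ∃ g : MvPolynomial (Fin 2 × σ) K, g ≠ 0 ∧ ∀ a, eval a g ≠ 0 →
      LinearIndependent K (Function.update b p fun j => a (0, j)) ∧
      LinearIndependent K
        (Function.update (Function.update b p fun j => a (0, j)) q fun j => a (1, j)) := by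
  let M : Matrix σ σ K := Matrix.of b
  let M₁ : Matrix σ σ (MvPolynomial (Fin 2 × σ) K) :=
    (M.map C).updateRow p fun j => X (0, j)
  let M₂ := M₁.updateRow q fun j => X (1, j)
  have h₁ : ∀ a, eval a M₁.det = (M.updateRow p fun j => a (0, j)).det := by
    intro a
    rw [RingHom.map_det, RingHom.mapMatrix_apply, Matrix.map_updateRow, Matrix.map_map]
    congr 2
    · ext; simp
    · ext; simp
  have h₂ : ∀ a, eval a M₂.det =
      ((M.updateRow p fun j => a (0, j)).updateRow q fun j => a (1, j)).det := by
    intro a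
    rw [RingHom.map_det, RingHom.mapMatrix_apply, Matrix.map_updateRow, Matrix.map_updateRow,
      Matrix.map_map]
    congr 2
    · congr 1
      · ext; simp
      · ext; simp
    · ext; simp
  let a₀ : Fin 2 × σ → K := fun x => if x.1 = 0 then b p x.2 else b q x.2
  have ha₁ : (M.updateRow p fun j => a₀ (0, j)) = M := Function.update_eq_self p b
  have ha₂ : (M.updateRow q fun j => a₀ (1, j)) = M := Function.update_eq_self q b
  have hM : M.det ≠ 0 := linearIndependent_iff_det_of_ne_zero.1 hb
  refine ⟨M₁.det * M₂.det, ?_, fun a ha => ?_⟩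
  · intro h
    have := congrArg (eval a₀) h
    rw [map_mul, h₁, h₂, ha₁, ha₂, map_zero] at this
    exact mul_ne_zero hM hM this
  · rw [map_mul, h₁, h₂] at ha
    exact ⟨linearIndependent_iff_det_of_ne_zero.2 (left_ne_zero_of_mul ha),
      linearIndependent_iff_det_of_ne_zero.2 (right_ne_zero_of_mul ha)⟩

lemma exists_adapted_family [DecidableEq σ] {c : ℕ} {s : Fin c → σ}
    (hs : Function.Injective s) {p q : σ} (hpq : p ≠ q) (hp : p ∉ Set.range s)
    (hq : q ∉ Set.range s ∨ ∀ j ≠ p, j ∈ Set.range s) {b : σ → σ → K}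
    (hb : LinearIndependent K b) {u w : σ → K}
    (hu : LinearIndependent K (Function.update b p u))
    (huw : LinearIndependent K (Function.update (Function.update b p u) q w)) :
    ∃ (b' : σ → σ → K) (α : K), LinearIndependent K b' ∧ b' p = u ∧ b' q = w + α • u ∧
      Submodule.span K (Set.range fun i => b' (s i)) =
        Submodule.span K (Set.range fun i => b (s i)) := by
  have : Nonempty σ := ⟨p⟩
  let B := basisOfLinearIndependentOfCardEqFinrank hu (by simp)
  have hB : ∀ j, B j = Function.update b p u j := by simp [B]
  let α := - B.repr w p
  let b' := Function.update (Function.update b p u) q (w + α • u)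
  have hb' : LinearIndependent K b' := by
    let A : Matrix σ σ K := Matrix.of (Function.update (Function.update b p u) q w)
    have hA : A.updateRow q (A q + α • A p) = Matrix.of b' := by
      have h₁ : A q = w := Function.update_self ..
      have h₂ : A p = u := (Function.update_of_ne hpq ..).trans (Function.update_self ..)
      rw [h₁, h₂]
      exact Function.update_idem ..
    rw [linearIndependent_iff_det_of_ne_zero, ← hA, Matrix.det_updateRow_add_smul_self A hpq.symm]
    exact linearIndependent_iff_det_of_ne_zero.1 huw
  have hsp : ∀ i, s i ≠ p := fun i h => hp ⟨i, h⟩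
  refine ⟨b', α, hb', by simp [b', hpq], by simp [b'], ?_⟩
  apply Submodule.eq_of_le_of_finrank_eq
  · rw [Submodule.span_le]
    rintro _ ⟨i, rfl⟩
    by_cases hi : s i = q
    · have hall := hq.resolve_left fun h => h ⟨i, hi⟩
      have hsum : w + α • u = ∑ j ∈ Finset.univ.erase p, B.repr w j • B j := by
        have h := B.sum_repr w
        rw [← Finset.add_sum_erase _ _ (Finset.mem_univ p), hB p, Function.update_self] at h
        nth_rewrite 1 [← h]
        simp only [α, neg_smul]
        abel
      simp only [b', hi, Function.update_self, SetLike.mem_coe]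
      rw [hsum]
      refine Submodule.sum_mem _ fun j hj => Submodule.smul_mem _ _ (Submodule.subset_span ?_)
      have hjp := Finset.ne_of_mem_erase hj
      obtain ⟨k, rfl⟩ := hall j hjp
      exact ⟨k, by simp [hB, hjp]⟩
    · exact Submodule.subset_span ⟨i, by simp [b', hi, hsp]⟩
  · have h₁ := finrank_span_eq_card (hb'.comp s hs)
    have h₂ := finrank_span_eq_card (hb.comp s hs)
    exact h₁.trans h₂.symm

lemma span_range_linForm_eq {ι κ : Type*} {v : ι → σ → K} {w : κ → σ → K}
    (h : Submodule.span K (Set.range v) = Submodule.span K (Set.range w)) :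
    Ideal.span (Set.range fun i => linForm (v i)) =
      Ideal.span (Set.range fun i => linForm (w i)) := by
  have h' := congrArg (fun V => Ideal.span (Submodule.map linForm V : Set (MvPolynomial σ K))) h
  simp only [Submodule.map_span, ← Set.range_comp] at h'
  have tower := Submodule.span_span_of_tower K (MvPolynomial σ K) (s := Set.range (linForm ∘ v))
  exact tower.symm.trans (h'.trans (Submodule.span_span_of_tower K (MvPolynomial σ K) _))

lemma span_pair_add_smul {A : Type*} [CommRing A] [Algebra K A] (x y : A) (α : K) :
    Ideal.span {x, y + α • x} = Ideal.span {x, y} := by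
  ext z
  simp only [Ideal.mem_span_pair, Algebra.smul_def]
  constructor
  · rintro ⟨r, t, rfl⟩
    exact ⟨r + t * algebraMap K A α, t, by ring⟩
  · rintro ⟨r, t, rfl⟩
    exact ⟨r - t * algebraMap K A α, t, by ring⟩

end LinearForms

/-- Let `H ⊆ ℙ^n` be a nonempty linear subspace of codimension `c ≥ 1`, cut out
by `c` independent linear forms, over an infinite field. Then for a *general* codimension-2
linear subspace `Q` (i.e. for all `Q`, parametrized by the coefficient matrix `a` of a pair of
linear forms, in the nonempty Zariski-open set where some fixed polynomial `g` does not vanish)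
and every `d ≥ 1`:
`dim [I(H) ∩ I(Q)^{d-1}]_d = d · codim H`; and in particular for any ideal `I(Z) ⊇ I(H)`
(e.g. the ideal of a finite set of points `Z ⊆ H`), `dim [I(Z) ∩ I(Q)^{d-1}]_d ≥ d · codim H`. -/
theorem stmt5 (K : Type*) [Field K] [Infinite K] (n c : ℕ) (hc : 1 ≤ c) (hcn : c ≤ n)
    (h : Fin c → MvPolynomial (Fin (n + 1)) K)
    (hdeg : ∀ i, h i ∈ homogeneousSubmodule (Fin (n + 1)) K 1)
    (hind : LinearIndependent K h) :
    ∃ g : MvPolynomial (Fin 2 × Fin (n + 1)) K, g ≠ 0 ∧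
      ∀ a : Fin 2 × Fin (n + 1) → K, MvPolynomial.eval a g ≠ 0 →
        ∀ d : ℕ, 1 ≤ d →
          (finrank K
              ↥(Submodule.restrictScalars K
                  (Ideal.span (Set.range h) ⊓
                    (Ideal.span {(∑ j : Fin (n + 1), MvPolynomial.C (a (0, j)) * X j :
                        MvPolynomial (Fin (n + 1)) K),
                      ∑ j : Fin (n + 1), MvPolynomial.C (a (1, j)) * X j}) ^ (d - 1)) ⊓
                homogeneousSubmodule (Fin (n + 1)) K d) = d * c) ∧
          ∀ IZ : Ideal (MvPolynomial (Fin (n + 1)) K), Ideal.span (Set.range h) ≤ IZ →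
            d * c ≤ finrank K
              ↥(Submodule.restrictScalars K
                  (IZ ⊓
                    (Ideal.span {(∑ j : Fin (n + 1), MvPolynomial.C (a (0, j)) * X j :
                        MvPolynomial (Fin (n + 1)) K),
                      ∑ j : Fin (n + 1), MvPolynomial.C (a (1, j)) * X j}) ^ (d - 1)) ⊓
                homogeneousSubmodule (Fin (n + 1)) K d) := by
  have hex : ∀ i, ∃ v, linForm v = h i := fun i => by
    have := hdeg i
    rwa [← range_linForm] at this
  choose v hv using hex
  obtain rfl : h = fun i => linForm (v i) := funext fun i => (hv i).symm
  obtain ⟨b, s, p, q, hb, hs, hbs, hpq, hp, hq⟩ :=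
    exists_linearIndependent_extension hc (by simp; omega) (hind.of_comp linForm)
  obtain rfl : v = fun i => b (s i) := funext fun i => (hbs i).symm
  obtain ⟨g, hg, hga⟩ := exists_ne_zero_linearIndependent_update hb p q
  refine ⟨g, hg, fun a ha d hd => ?_⟩
  obtain ⟨hu, huw⟩ := hga a ha
  obtain ⟨b', α, hb', hbp, hbq, hspan⟩ := exists_adapted_family hs hpq hp hq hb hu huw
  have main := finrank_span_inf_span_pair_pow_of_adapted hd hs hpq hp hq hb'
    (I := Ideal.span (Set.range fun i => linForm (b (s i))))
    (J := Ideal.span {linForm fun j => a (0, j), linForm fun j => a (1, j)})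
    (span_range_linForm_eq hspan.symm)
    (by rw [hbp, hbq, map_add, map_smul, span_pair_add_smul])
  have hform : ∀ k, ∑ j, C (a (k, j)) * X j = linForm fun j => a (k, j) :=
    fun k => (linForm_apply _).symm
  rw [hform 0, hform 1]
  refine ⟨main, fun IZ hIZ => main.symm.le.trans ?_⟩
  have hfin : FiniteDimensional K (homogeneousSubmodule (Fin (n + 1)) K d) :=
    Module.Finite.iff_fg.2 (homogeneousSubmodule_fg _ _ d)
  have := Submodule.finiteDimensional_of_le (inf_le_right :
    Submodule.restrictScalars K (IZ ⊓ Ideal.span {linForm fun j => a (0, j),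
      linForm fun j => a (1, j)} ^ (d - 1)) ⊓ homogeneousSubmodule (Fin (n + 1)) K d ≤ _)
  exact Submodule.finrank_mono (inf_le_inf_right _ fun f hf => ⟨hIZ hf.1, hf.2⟩)
end

section
/- Let Z be a finite set of points in P^2 over an algebraically closed field K with |Z| ≥ 2, and let P ∈ P^2. Let L_P(Z) = { Span(Q,P) : Q ∈ Z \ {P} } be the set of lines through P spanned with points of Z. Then |L_P(Z)| equals the minimum integer d such that [I(Z) ∩ I(P)^d]_d ≠ 0, i.e., the least degree of a nonzero curve through Z with multiplicity d at P. Moreover, [I(Z) ∩ I(P)^d]_d is spanned by multiples of the product G_P of the linear forms defining the lines in L_P(Z). -/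
open MvPolynomial Module
open scoped LinearAlgebra.Projectivization

theorem MvPolynomial.IsHomogeneous.eval_smul {σ R : Type*} [CommSemiring R]
    {f : MvPolynomial σ R} {d : ℕ} (hf : f.IsHomogeneous d) (a : R) (v : σ → R) :
    eval (a • v) f = a ^ d * eval v f := by
  rw [eval_eq, eval_eq, Finset.mul_sum]
  refine Finset.sum_congr rfl fun s hs => ?_
  have hd : ∑ i ∈ s.support, s i = d := by
    rw [hf.degree_eq_sum_deg_support hs]
  simp only [Pi.smul_apply, smul_eq_mul, mul_pow, Finset.prod_mul_distrib,
    Finset.prod_pow_eq_pow_sum, hd]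
  ring

theorem MvPolynomial.IsHomogeneous.exists_linearMap_eval_eq {σ R : Type*} [CommSemiring R]
    {f : MvPolynomial σ R} (hf : f.IsHomogeneous 1) :
    ∃ φ : (σ → R) →ₗ[R] R, ∀ v, eval v f = φ v := by
  rw [← mem_homogeneousSubmodule, homogeneousSubmodule_one_eq_span_X] at hf
  induction hf using Submodule.span_induction with
  | mem x h =>
    obtain ⟨i, rfl⟩ := h
    exact ⟨LinearMap.proj i, fun v => by simp⟩
  | zero => exact ⟨0, fun v => by simp⟩
  | add x y _ _ hx hy =>
    obtain ⟨φ, hφ⟩ := hx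
    obtain ⟨ψ, hψ⟩ := hy
    exact ⟨φ + ψ, fun v => by simp [hφ, hψ]⟩
  | smul a x _ hx =>
    obtain ⟨φ, hφ⟩ := hx
    exact ⟨a • φ, fun v => by simp [smul_eval, hφ]⟩

theorem MvPolynomial.irreducible_of_isHomogeneous_one {σ K : Type*} [Field K]
    {f : MvPolynomial σ K} (hf : f.IsHomogeneous 1) (h0 : f ≠ 0) : Irreducible f := by
  refine irreducible_of_totalDegree_eq_one (hf.totalDegree h0) fun x hx => ?_
  obtain ⟨i, hi⟩ := ne_zero_iff.mp h0
  exact isUnit_of_dvd_unit (hx i) hi.isUnit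

theorem MvPolynomial.dvd_of_forall_eval_eq_zero {σ K : Type*} [Finite σ] [Field K]
    [IsAlgClosed K] {p f : MvPolynomial σ K} (hp : Prime p)
    (h : ∀ v, eval v p = 0 → eval v f = 0) : p ∣ f := by
  have hmem : f ∈ vanishingIdeal K (zeroLocus K (Ideal.span {p})) := by
    rw [mem_vanishingIdeal_iff]
    intro v hv
    have := hv p (Ideal.mem_span_singleton_self p)
    rw [aeval_eq_eval] at *
    exact h v this
  rw [vanishingIdeal_zeroLocus_eq_radical,
    ((Ideal.span_singleton_prime hp.ne_zero).2 hp).radical] at hmem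
  exact Ideal.mem_span_singleton.1 hmem

theorem MvPolynomial.polynomial_eval_aeval {σ R : Type*} [CommSemiring R]
    (f : MvPolynomial σ R) (g : σ → Polynomial R) (s : R) :
    (aeval g f).eval s = eval (fun i => (g i).eval s) f := by
  have := MvPolynomial.map_aeval g (Polynomial.evalRingHom s) f
  simp only [Polynomial.coe_evalRingHom] at this
  rw [this, eval]
  congr 2
  ext
  simp

/-- A form of degree `d` with a point of multiplicity `d` at `p` is invariant under translation
by `p`. -/
theorem MvPolynomial.IsHomogeneous.eval_add_smul_of_mem_pow {σ K : Type*} [Field K] [Infinite K]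
    {f : MvPolynomial σ K} {d : ℕ} (hf : f.IsHomogeneous d) {p : σ → K}
    (hfp : f ∈ Ideal.span {g : MvPolynomial σ K |
      g ∈ homogeneousSubmodule σ K 1 ∧ eval p g = 0} ^ d) (v : σ → K) (u : K) :
    eval (v + u • p) f = eval v f := by
  obtain ⟨c, hc⟩ : ∃ c : K, ∀ s : K, eval (s • v + p) f = s ^ d * c := by
    let φ : MvPolynomial σ K →ₐ[K] Polynomial K :=
      MvPolynomial.aeval fun i => Polynomial.C (v i) * Polynomial.X + Polynomial.C (p i)
    have heval : ∀ g s, (φ g).eval s = eval (s • v + p) g := fun g s => by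
      rw [polynomial_eval_aeval]
      congr 2
      ext i
      simp [mul_comm s]
    have hle : (Ideal.span {g : MvPolynomial σ K |
        g ∈ homogeneousSubmodule σ K 1 ∧ eval p g = 0}).map φ ≤
        Ideal.span {Polynomial.X} := by
      rw [Ideal.map_span, Ideal.span_le]
      rintro _ ⟨g, ⟨-, hg⟩, rfl⟩
      rw [SetLike.mem_coe, Ideal.mem_span_singleton, Polynomial.X_dvd_iff,
        Polynomial.coeff_zero_eq_eval_zero, heval]
      simpa using hg
    have hdvd : Polynomial.X ^ d ∣ φ f := by
      rw [← Ideal.mem_span_singleton, ← Ideal.span_singleton_pow]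
      apply Ideal.pow_right_mono hle d
      rw [← Ideal.map_pow]
      exact Ideal.mem_map_of_mem φ hfp
    have hdeg : (φ f).natDegree ≤ d := by
      simpa using aeval_natDegree_le f hf.totalDegree_le _ (n := 1) fun i =>
        (by compute_degree :
          (Polynomial.C (v i) * Polynomial.X + Polynomial.C (p i)).natDegree ≤ 1)
    refine ⟨(φ f).coeff d, fun s => ?_⟩
    have hφ : φ f = Polynomial.C ((φ f).coeff d) * Polynomial.X ^ d := by
      ext n
      rw [Polynomial.coeff_C_mul_X_pow]
      split_ifs with h
      · rw [h]
      · rcases lt_or_gt_of_ne h with h | h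
        · exact Polynomial.X_pow_dvd_iff.1 hdvd n h
        · exact Polynomial.coeff_eq_zero_of_natDegree_lt (hdeg.trans_lt h)
    rw [← heval, congrArg (Polynomial.eval s) hφ, Polynomial.eval_C_mul, Polynomial.eval_pow,
      Polynomial.eval_X, mul_comm]
  have hne : ∀ u : K, u ≠ 0 → eval (v + u • p) f = c := fun u hu => by
    have : v + u • p = u • (u⁻¹ • v + p) := by
      rw [smul_add, smul_inv_smul₀ hu]
    rw [this, hf.eval_smul, hc, ← mul_assoc, ← mul_pow, mul_inv_cancel₀ hu, one_pow, one_mul]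
  let q : Polynomial K :=
    MvPolynomial.aeval (fun i => Polynomial.C (v i) + Polynomial.X * Polynomial.C (p i)) f
  have hq : ∀ u, q.eval u = eval (v + u • p) f := fun u => by
    rw [polynomial_eval_aeval]
    congr 2
    ext i
    simp [mul_comm u]
  have hqc : q = Polynomial.C c := by
    refine Polynomial.eq_of_infinite_eval_eq _ _
      ((Set.finite_singleton (0 : K)).infinite_compl.mono fun u hu => ?_)
    simpa [hq] using hne u hu
  have hall : ∀ u : K, eval (v + u • p) f = c := fun u => by rw [← hq, hqc, Polynomial.eval_C]
  rw [hall u, ← hall 0, zero_smul, add_zero]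

theorem MvPolynomial.eval_eq_zero_iff_mem_of_finrank_eq {K : Type*} [Field K] [Infinite K] {n : ℕ}
    {f : MvPolynomial (Fin (n + 1)) K} (hf : f.IsHomogeneous 1) (h0 : f ≠ 0)
    {L : Submodule K (Fin (n + 1) → K)} (hL : finrank K L = n) (h : ∀ v ∈ L, eval v f = 0)
    (v : Fin (n + 1) → K) : eval v f = 0 ↔ v ∈ L := by
  obtain ⟨φ, hφ⟩ := hf.exists_linearMap_eval_eq
  have hφ0 : φ ≠ 0 := by
    rintro rfl
    exact h0 (funext fun v => by simp [hφ])
  have hker : LinearMap.ker φ < ⊤ :=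
    lt_top_iff_ne_top.2 fun hk => hφ0 (LinearMap.ker_eq_top.1 hk)
  have hlt := Submodule.finrank_lt hker.ne
  rw [finrank_fin_fun] at hlt
  have hle : L ≤ LinearMap.ker φ := fun w hw => by
    rw [LinearMap.mem_ker, ← hφ]; exact h w hw
  rw [Submodule.eq_of_le_of_finrank_le hle (by lia), LinearMap.mem_ker, hφ]

theorem Projectivization.finrank_submodule_sup {K V : Type*} [Field K] [AddCommGroup V]
    [Module K V] {P Q : ℙ K V} (h : P ≠ Q) : finrank K ↥(P.submodule ⊔ Q.submodule) = 2 := by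
  rw [submodule_eq, submodule_eq, ← Submodule.span_union, Set.singleton_union,
    ← Matrix.range_cons_cons_empty P.rep Q.rep ![]]
  simpa using finrank_span_eq_card (linearIndependent_pair_iff_ne.2 h)

theorem Projectivization.rep_mem_submodule {K V : Type*} [Field K] [AddCommGroup V]
    [Module K V] (P : ℙ K V) : P.rep ∈ P.submodule := by
  rw [submodule_eq]
  exact Submodule.mem_span_singleton_self _

set_option maxHeartbeats 800000 in
open scoped Classical in
/-- For a finite set `Z ⊆ ℙ^2` with `|Z| ≥ 2` over an algebraically closed
field and a point `P ∈ ℙ^2`, let `L_P(Z) = {Span(Q,P) : Q ∈ Z \ {P}}`. Then `|L_P(Z)|`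
is the least degree `d` for which there is a nonzero degree-`d` form vanishing on `Z`
and lying in `I(P)^d` (vanishing to order `d` at `P`); moreover `[I(Z) ∩ I(P)^m]_m`
(for `m = |L_P(Z)|`) is spanned by the product `G_P` of the linear forms defining the
lines of `L_P(Z)`. -/
theorem stmt11 (K : Type*) [Field K] [IsAlgClosed K]
    (Z : Finset (ℙ K (Fin 3 → K))) (hZ : 2 ≤ Z.card) (P : ℙ K (Fin 3 → K))
    (ℓfun : Submodule K (Fin 3 → K) → MvPolynomial (Fin 3) K)
    (hℓ : ∀ L : Submodule K (Fin 3 → K), Module.finrank K L = 2 →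
      ℓfun L ∈ homogeneousSubmodule (Fin 3) K 1 ∧ ℓfun L ≠ 0 ∧
        ∀ v ∈ L, MvPolynomial.eval v (ℓfun L) = 0) :
    let lines : Finset (Submodule K (Fin 3 → K)) :=
      (Z.erase P).image fun Q =>
        Projectivization.submodule P ⊔ Projectivization.submodule Q
    let IP : Ideal (MvPolynomial (Fin 3) K) :=
      Ideal.span {f : MvPolynomial (Fin 3) K |
        f ∈ homogeneousSubmodule (Fin 3) K 1 ∧ MvPolynomial.eval P.rep f = 0}
    let GP : MvPolynomial (Fin 3) K := ∏ L ∈ lines, ℓfun L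
    (lines.card = sInf {d : ℕ | ∃ f ∈ homogeneousSubmodule (Fin 3) K d, f ≠ 0 ∧
        (∀ Q ∈ Z, MvPolynomial.eval (Projectivization.rep Q) f = 0) ∧ f ∈ IP ^ d}) ∧
    (∀ f ∈ homogeneousSubmodule (Fin 3) K lines.card,
      (∀ Q ∈ Z, MvPolynomial.eval (Projectivization.rep Q) f = 0) →
      f ∈ IP ^ lines.card → ∃ c : K, f = MvPolynomial.C c * GP) := by
  intro lines IP GP
  have hlines : ∀ L ∈ lines, finrank K L = 2 := by
    intro L hL
    obtain ⟨Q, hQ, rfl⟩ := Finset.mem_image.1 hL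
    exact Projectivization.finrank_submodule_sup (Finset.ne_of_mem_erase hQ).symm
  have hP : ∀ L ∈ lines, P.rep ∈ L := by
    intro L hL
    obtain ⟨Q, hQ, rfl⟩ := Finset.mem_image.1 hL
    exact Submodule.mem_sup_left P.rep_mem_submodule
  have hzero : ∀ L ∈ lines, ∀ v, eval v (ℓfun L) = 0 ↔ v ∈ L := fun L hL =>
    let ⟨h1, h2, h3⟩ := hℓ L (hlines L hL)
    eval_eq_zero_iff_mem_of_finrank_eq h1 h2 (hlines L hL) h3
  have hirr : ∀ L ∈ lines, Irreducible (ℓfun L) := fun L hL =>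
    let ⟨h1, h2, _⟩ := hℓ L (hlines L hL)
    irreducible_of_isHomogeneous_one h1 h2
  have hGPhom : GP.IsHomogeneous lines.card := by
    simpa using IsHomogeneous.prod lines ℓfun (fun _ => 1) fun L hL => (hℓ L (hlines L hL)).1
  have hGP0 : GP ≠ 0 := Finset.prod_ne_zero_iff.2 fun L hL => (hℓ L (hlines L hL)).2.1
  have hGPZ : ∀ Q ∈ Z, eval Q.rep GP = 0 := by
    intro Q hQ
    obtain ⟨L, hL, hQL⟩ : ∃ L ∈ lines, Q.rep ∈ L := by
      by_cases hQP : Q = P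
      · obtain ⟨R, hR, hRP⟩ := Finset.exists_mem_ne hZ P
        have hL := Finset.mem_image_of_mem (fun Q => P.submodule ⊔ Q.submodule)
          (Finset.mem_erase.2 ⟨hRP, hR⟩)
        exact ⟨_, hL, hQP ▸ hP _ hL⟩
      · exact ⟨_, Finset.mem_image_of_mem _ (Finset.mem_erase.2 ⟨hQP, hQ⟩),
          Submodule.mem_sup_right Q.rep_mem_submodule⟩
    rw [map_prod]
    exact Finset.prod_eq_zero hL ((hzero L hL _).2 hQL)
  have hGPIP : GP ∈ IP ^ lines.card := by
    rw [← Finset.prod_const]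
    exact Ideal.prod_mem_prod fun L hL =>
      Ideal.subset_span ⟨(hℓ L (hlines L hL)).1, (hzero L hL _).2 (hP L hL)⟩
  have hdvd : ∀ d, ∀ f ∈ homogeneousSubmodule (Fin 3) K d,
      (∀ Q ∈ Z, eval Q.rep f = 0) → f ∈ IP ^ d → GP ∣ f := by
    intro d f hf hfZ hfP
    refine Finset.prod_dvd_of_isRelPrime (fun L hL L' hL' hne => ?_) fun L hL => ?_
    · refine (hirr L hL).isRelPrime_iff_not_dvd.2 fun ⟨g, hg⟩ => hne ?_
      refine Submodule.eq_of_le_of_finrank_eq (fun v hv => ?_)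
        ((hlines L hL).trans (hlines L' hL').symm)
      rw [← hzero L' hL', hg, map_mul, (hzero L hL v).2 hv, zero_mul]
    · refine dvd_of_forall_eval_eq_zero (hirr L hL).prime fun v hv => ?_
      rw [hzero L hL] at hv
      obtain ⟨Q, hQ, rfl⟩ := Finset.mem_image.1 hL
      simp only [Projectivization.submodule_eq, Submodule.mem_sup,
        Submodule.mem_span_singleton] at hv
      obtain ⟨_, ⟨a, rfl⟩, _, ⟨b, rfl⟩, rfl⟩ := hv
      rw [add_comm, IsHomogeneous.eval_add_smul_of_mem_pow hf hfP, IsHomogeneous.eval_smul hf,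
        hfZ Q (Finset.mem_of_mem_erase hQ), mul_zero]
  refine ⟨le_antisymm (le_csInf ⟨_, GP, hGPhom, hGP0, hGPZ, hGPIP⟩ ?_)
    (Nat.sInf_le ⟨GP, hGPhom, hGP0, hGPZ, hGPIP⟩), fun f hf hfZ hfP => ?_⟩
  · rintro d ⟨f, hf, hf0, hfZ, hfP⟩
    rw [← hGPhom.totalDegree hGP0, ← IsHomogeneous.totalDegree hf hf0]
    exact totalDegree_le_of_dvd_of_isDomain (hdvd d f hf hfZ hfP) hf0
  · obtain ⟨g, rfl⟩ := hdvd _ f hf hfZ hfP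
    rcases eq_or_ne g 0 with rfl | hg
    · exact ⟨0, by simp⟩
    · have hdeg := IsHomogeneous.totalDegree hf (mul_ne_zero hGP0 hg)
      rw [totalDegree_mul_of_isDomain hGP0 hg, hGPhom.totalDegree hGP0] at hdeg
      exact ⟨_, by rw [mul_comm, ← totalDegree_eq_zero_iff_eq_C.1 (by lia : g.totalDegree = 0)]⟩
end

section
/- Let K be a field and A = K[s,t] the polynomial ring in two variables. The set of d-th powers {ℓ^d : ℓ ∈ [A]_1} of linear forms spans the K-vector space [A]_d of degree-d forms if and only if either char K = 0, or char K = p > 0 and d = q·p^e - 1 for some e ≥ 0 and 1 ≤ q ≤ p. Equivalently, the product of binomial coefficients ∏_{i=0}^d binom(d,i) is nonzero in K iff this condition holds (using Lucas's theorem). -/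
open MvPolynomial

/-- If `∑ a ^ i • v i` lies in a subspace for every scalar `a` of an infinite field, then so does
every `v i`. -/
theorem mem_of_forall_sum_pow_smul_mem {K V : Type*} [Field K] [Infinite K] [AddCommGroup V]
    [Module K V] (W : Submodule K V) (n : ℕ) (v : ℕ → V)
    (h : ∀ a : K, ∑ i ∈ Finset.range n, a ^ i • v i ∈ W) {i : ℕ} (hi : i < n) : v i ∈ W := by
  by_contra hv
  obtain ⟨f, hf, hW⟩ := Submodule.exists_le_ker_of_notMem hv
  have hP : (∑ j ∈ Finset.range n, Polynomial.C (f (v j)) * Polynomial.X ^ j) = 0 := by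
    refine Polynomial.funext fun a => ?_
    have ha : f (∑ i ∈ Finset.range n, a ^ i • v i) = 0 := hW (h a)
    simp only [map_sum, map_smul, smul_eq_mul] at ha
    simp only [Polynomial.eval_finsetSum, Polynomial.eval_mul, Polynomial.eval_C,
      Polynomial.eval_pow, Polynomial.eval_X, Polynomial.eval_zero]
    rw [← ha]
    exact Finset.sum_congr rfl fun j _ => mul_comm _ _
  have hc := congrArg (fun P => Polynomial.coeff P i) hP
  simp [Polynomial.finsetSum_coeff, Polynomial.coeff_C_mul, Polynomial.coeff_X_pow, hi] at hc
  exact hf hc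

/-- The degree-`d` coefficients of the `d`-th power of a binary linear form. -/
theorem C_mul_X_add_C_mul_X_pow {K : Type*} [Field K] (a b : K) (d : ℕ) :
    (C a * X 0 + C b * X 1 : MvPolynomial (Fin 2) K) ^ d =
      ∑ i ∈ Finset.range (d + 1),
        monomial (Finsupp.single 0 i + Finsupp.single 1 (d - i))
          (a ^ i * b ^ (d - i) * (d.choose i : K)) := by
  rw [add_pow]
  refine Finset.sum_congr rfl fun i _ => ?_
  rw [monomial_eq, Finsupp.prod_add_index' (by simp) (by intros; rw [pow_add])]
  simp [mul_pow]
  ring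

/-- A binary linear form is a linear combination of the two variables. -/
theorem exists_eq_of_mem_homogeneousSubmodule_one {K : Type*} [Field K]
    {l : MvPolynomial (Fin 2) K} (hl : l ∈ homogeneousSubmodule (Fin 2) K 1) :
    ∃ a b : K, l = C a * X 0 + C b * X 1 := by
  rw [homogeneousSubmodule_one_eq_span_X] at hl
  rw [show Set.range (X : Fin 2 → MvPolynomial (Fin 2) K) = {X 0, X 1} by
    ext; simp [Fin.exists_fin_two, eq_comm], Submodule.mem_span_pair] at hl
  obtain ⟨a, b, rfl⟩ := hl
  exact ⟨a, b, by simp [smul_eq_C_mul]⟩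

theorem span_pow_eq_iff_forall_choose_ne_zero (K : Type*) [Field K] [Infinite K] (d : ℕ) :
    Submodule.span K {f : MvPolynomial (Fin 2) K |
        ∃ ℓ ∈ homogeneousSubmodule (Fin 2) K 1, f = ℓ ^ d} =
      (homogeneousSubmodule (Fin 2) K d : Submodule K (MvPolynomial (Fin 2) K)) ↔
    ∀ i ≤ d, (d.choose i : K) ≠ 0 := by
  constructor
  · intro h i hi h0
    set m : Fin 2 →₀ ℕ := Finsupp.single 0 i + Finsupp.single 1 (d - i) with hm
    have hmem : monomial m (1 : K) ∈ homogeneousSubmodule (Fin 2) K d := by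
      refine isHomogeneous_monomial _ ?_
      rw [hm, map_add, Finsupp.degree_single, Finsupp.degree_single]
      omega
    rw [← h] at hmem
    have hle : Submodule.span K {f : MvPolynomial (Fin 2) K |
        ∃ ℓ ∈ homogeneousSubmodule (Fin 2) K 1, f = ℓ ^ d} ≤ LinearMap.ker (lcoeff K m) := by
      rw [Submodule.span_le]
      rintro _ ⟨l, hl, rfl⟩
      obtain ⟨a, b, rfl⟩ := exists_eq_of_mem_homogeneousSubmodule_one hl
      rw [SetLike.mem_coe, LinearMap.mem_ker, lcoeff_apply, C_mul_X_add_C_mul_X_pow, coeff_sum]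
      refine Finset.sum_eq_zero fun j _ => ?_
      rw [coeff_monomial]
      split_ifs with hj
      · have : j = i := by simpa [hm] using DFunLike.congr_fun hj 0
        rw [this, h0, mul_zero]
      · rfl
    have := hle hmem
    simp at this
  · intro h
    refine le_antisymm (Submodule.span_le.2 ?_) fun f hf => ?_
    · rintro _ ⟨l, hl, rfl⟩
      have := ((mem_homogeneousSubmodule 1 l).1 hl).pow d
      simpa using this
    · rw [f.as_sum]
      refine Submodule.sum_mem _ fun m hm => ?_
      have hdeg : m 0 + m 1 = d := by
        have := (mem_homogeneousSubmodule d f).1 hf (mem_support_iff.1 hm)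
        simpa [Finsupp.weight_apply, Finsupp.sum_fintype] using this
      have hi : m 0 < d + 1 := by omega
      have key := mem_of_forall_sum_pow_smul_mem (Submodule.span K {f : MvPolynomial (Fin 2) K |
        ∃ ℓ ∈ homogeneousSubmodule (Fin 2) K 1, f = ℓ ^ d}) (d + 1)
        (fun i => monomial (Finsupp.single 0 i + Finsupp.single 1 (d - i)) (d.choose i : K))
        (fun a => by
          refine Submodule.subset_span ⟨C a * X 0 + C 1 * X 1, ?_, ?_⟩
          · exact ((isHomogeneous_C_mul_X a 0).add (isHomogeneous_C_mul_X 1 1))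
          · rw [C_mul_X_add_C_mul_X_pow]
            simp [smul_monomial]) hi
      have hmm : (Finsupp.single 0 (m 0) + Finsupp.single 1 (d - m 0) : Fin 2 →₀ ℕ) = m := by
        ext j
        fin_cases j
        · simp
        · simp; omega
      have := Submodule.smul_mem _ (coeff m f * (d.choose (m 0) : K)⁻¹) key
      simp only [hmm, smul_monomial, smul_eq_mul] at this
      rwa [inv_mul_cancel_right₀ (h _ (by omega))] at this

theorem Nat.Prime.not_dvd_choose_of_lt {p n k : ℕ} (hp : p.Prime) (hn : n < p) (hk : k ≤ n) :
    ¬ p ∣ n.choose k := fun h =>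
  hn.not_ge <| hp.dvd_factorial.1 <| by
    rw [← Nat.choose_mul_factorial_mul_factorial hk, mul_assoc]
    exact h.mul_right _

theorem Nat.Prime.dvd_choose_iff_mod_or_div {p : ℕ} (hp : p.Prime) (n k : ℕ) :
    p ∣ n.choose k ↔ p ∣ (n % p).choose (k % p) ∨ p ∣ (n / p).choose (k / p) := by
  have : Fact p.Prime := ⟨hp⟩
  rw [← hp.dvd_mul]
  exact (Choose.choose_modEq_choose_mod_mul_choose_div_nat (n := n) (k := k) (p := p)).dvd_iff
    dvd_rfl

theorem Nat.Prime.forall_not_dvd_choose_iff {p : ℕ} (hp : p.Prime) (d : ℕ) :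
    (∀ i ≤ d, ¬ p ∣ d.choose i) ↔ ∃ e q : ℕ, 1 ≤ q ∧ q ≤ p ∧ d + 1 = q * p ^ e := by
  constructor
  · induction d using Nat.strong_induction_on with
    | _ d ih =>
      intro h
      rcases lt_or_ge d p with hd | hd
      · exact ⟨0, d + 1, by omega, hd, by simp⟩
      have hlt := Nat.mod_lt d hp.pos
      have hmod : d % p = p - 1 := by
        by_contra hne
        refine h (p - 1) (by omega) ((hp.dvd_choose_iff_mod_or_div _ _).2 (Or.inl ?_))
        rw [Nat.mod_eq_of_lt (Nat.sub_lt hp.pos one_pos), Nat.choose_eq_zero_of_lt (by omega)]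
        exact dvd_zero p
      obtain ⟨e, q, hq, hqp, he⟩ := ih (d / p) (Nat.div_lt_self (hp.pos.trans_le hd) hp.one_lt)
        fun j hj hdvd => h (p * j) ((Nat.mul_le_mul_left p hj).trans (Nat.mul_div_le d p)) <|
          (hp.dvd_choose_iff_mod_or_div _ _).2 <| Or.inr <| by
            rwa [Nat.mul_div_cancel_left j hp.pos]
      refine ⟨e + 1, q, hq, hqp, ?_⟩
      have hdiv := Nat.div_add_mod d p
      have hpos := hp.pos
      calc d + 1 = p * (d / p + 1) := by rw [mul_add]; omega
        _ = q * p ^ (e + 1) := by rw [he]; ring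
  · rintro ⟨e, q, hq, hqp, he⟩
    induction e generalizing d with
    | zero => exact fun i hi => hp.not_dvd_choose_of_lt (by simp at he; omega) hi
    | succ e ih =>
      intro i hi
      have hpos : 0 < q * p ^ e := Nat.mul_pos hq (pow_pos hp.pos e)
      obtain ⟨c, hc⟩ : ∃ c, q * p ^ e = c + 1 := ⟨q * p ^ e - 1, by omega⟩
      have hp0 := hp.pos
      have hd : d = (p - 1) + p * c := by
        have : d + 1 = p * (c + 1) := by rw [he, ← hc]; ring
        rw [mul_add] at this
        omega
      have hmod : d % p = p - 1 := by
        rw [hd, Nat.add_mul_mod_self_left, Nat.mod_eq_of_lt (by omega)]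
      have hdiv : d / p = c := by
        rw [hd, Nat.add_mul_div_left _ _ hp0, Nat.div_eq_of_lt (by omega), zero_add]
      rw [hp.dvd_choose_iff_mod_or_div, hmod, hdiv]
      have := Nat.mod_lt i hp0
      exact not_or.2 ⟨hp.not_dvd_choose_of_lt (by omega) (by omega),
        ih c hc.symm _ (hdiv ▸ Nat.div_le_div_right hi)⟩

/-- In `A = K[s,t]` over an infinite field `K`, the `d`-th powers of linear
forms span the space `[A]_d` of degree-`d` forms if and only if `char K = 0`, or
`char K = p > 0` and `d = q·p^e - 1` for some `e ≥ 0` and `1 ≤ q ≤ p`. -/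
theorem stmt14 (K : Type*) [Field K] [Infinite K] (d : ℕ) :
    Submodule.span K {f : MvPolynomial (Fin 2) K |
        ∃ ℓ ∈ homogeneousSubmodule (Fin 2) K 1, f = ℓ ^ d} =
      (homogeneousSubmodule (Fin 2) K d : Submodule K (MvPolynomial (Fin 2) K)) ↔
    (CharZero K ∨ ∃ p e q : ℕ, p.Prime ∧ CharP K p ∧ 1 ≤ q ∧ q ≤ p ∧ d + 1 = q * p ^ e) := by
  rw [span_pow_eq_iff_forall_choose_ne_zero]
  constructor
  · intro h
    obtain ⟨p, hK⟩ := CharP.exists K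
    rcases CharP.char_is_prime_or_zero K p with hp | rfl
    · obtain ⟨e, q, hq⟩ := (hp.forall_not_dvd_choose_iff d).1 fun i hi hdvd =>
        h i hi ((CharP.cast_eq_zero_iff K p _).2 hdvd)
      exact Or.inr ⟨p, e, q, hp, hK, hq⟩
    · exact Or.inl (CharP.charP_to_charZero K)
  · rintro (hK | ⟨p, e, q, hp, hK, hq⟩) i hi
    · exact Nat.cast_ne_zero.2 (Nat.choose_pos hi).ne'
    · rw [Ne, CharP.cast_eq_zero_iff K p]
      exact (hp.forall_not_dvd_choose_iff d).2 ⟨e, q, hq⟩ i hi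
end
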